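/- Let α : ℝ → ℝ be locally integrable with ∫_{s-τ}^{s} α ≥ 1 for all s ∈ ℝ, where τ > 0 is fixed. Then for every s ∈ ℝ, ∫_{-∞}^{s} exp(-∫_σ^{s} α(ρ)dρ) dσ ≤ 2τ · sup_{0≤r≤1} exp(-∫_{s-rτ}^{s} α). -/

import Mathlib

open MeasureTheory Filter Real

/-- If a continuous function halves at each backward step of length `τ` and is bounded by `M` on
`[s - τ, s]`, then its integral over `n` backward periods is at most `2 * τ * M`. -/
theorem intervalIntegral_le_of_backward_halving {f : ℝ → ℝ} {τ M s : ℝ} (hf : Continuous f)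
    (hτ : 0 < τ) (hM : 0 ≤ M) (hstep : ∀ x, f (x - τ) ≤ f x / 2)
    (hbound : ∀ x ∈ Set.Icc (s - τ) s, f x ≤ M) (n : ℕ) :
    ∫ x in (s - n * τ)..s, f x ≤ 2 * τ * M := by
  induction n with
  | zero => simp; positivity
  | succ n ih =>
    have hsplit : ∫ x in (s - (n + 1 : ℕ) * τ)..s, f x =
        (∫ x in (s - n * τ)..s, f (x - τ)) + ∫ x in (s - τ)..s, f x := by
      rw [intervalIntegral.integral_comp_sub_right f τ,
        intervalIntegral.integral_add_adjacent_intervals (hf.intervalIntegrable _ _)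
          (hf.intervalIntegrable _ _)]
      congr 1
      push_cast
      ring
    have hpast : ∫ x in (s - n * τ)..s, f (x - τ) ≤ ∫ x in (s - n * τ)..s, f x / 2 :=
      intervalIntegral.integral_mono (sub_le_self s (by positivity))
        (Continuous.intervalIntegrable (by fun_prop) _ _)
        (Continuous.intervalIntegrable (by fun_prop) _ _) hstep
    have hlast : ∫ x in (s - τ)..s, f x ≤ ∫ _x in (s - τ)..s, M :=
      intervalIntegral.integral_mono_on (sub_le_self s hτ.le) (hf.intervalIntegrable _ _)
        (by simp) hbound
    rw [intervalIntegral.integral_div] at hpast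
    rw [intervalIntegral.integral_const, smul_eq_mul, sub_sub_cancel] at hlast
    linarith

/-- Integral form over a half-line of `intervalIntegral_le_of_backward_halving`. -/
theorem integral_Iic_le_of_backward_halving {f : ℝ → ℝ} {τ M s : ℝ} (hf : Continuous f)
    (hτ : 0 < τ) (hM : 0 ≤ M) (hstep : ∀ x, f (x - τ) ≤ f x / 2)
    (hbound : ∀ x ∈ Set.Icc (s - τ) s, f x ≤ M) :
    ∫ x in Set.Iic s, f x ≤ 2 * τ * M := by
  by_cases hint : IntegrableOn f (Set.Iic s)
  · have hlim : Tendsto (fun n : ℕ => s - n * τ) atTop atBot :=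
      tendsto_atBot_add_const_left _ s
        (tendsto_neg_atTop_atBot.comp (tendsto_natCast_atTop_atTop.atTop_mul_const hτ))
    exact le_of_tendsto' (intervalIntegral_tendsto_integral_Iic s hint hlim)
      (intervalIntegral_le_of_backward_halving hf hτ hM hstep hbound)
  · rw [integral_undef hint]
    positivity

/-- Core integral estimate in the proof of the backward Gronwall lemma. -/
theorem stmt_9 (α : ℝ → ℝ) (τ : ℝ) (hτ : 0 < τ)
    (hα : LocallyIntegrable α)
    (hα_int : ∀ s : ℝ, 1 ≤ ∫ ρ in (s - τ)..s, α ρ) :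
    ∀ s : ℝ,
      (∫ σ in Set.Iic s, Real.exp (-∫ ρ in σ..s, α ρ)) ≤
        2 * τ * ⨆ r : Set.Icc (0 : ℝ) 1,
          Real.exp (-∫ ρ in (s - (r : ℝ) * τ)..s, α ρ) := by
  intro s
  have hii (a b : ℝ) : IntervalIntegrable α volume a b :=
    (hα.integrableOn_isCompact isCompact_uIcc).intervalIntegrable
  have hcont : Continuous fun σ => exp (-∫ ρ in σ..s, α ρ) := by
    simp_rw [← intervalIntegral.integral_symm]
    exact continuous_exp.comp (intervalIntegral.continuous_primitive hii s)
  have hbdd : BddAbove (Set.range fun r : Set.Icc (0 : ℝ) 1 =>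
      exp (-∫ ρ in (s - (r : ℝ) * τ)..s, α ρ)) :=
    (isCompact_range (hcont.comp (g := fun σ => exp (-∫ ρ in σ..s, α ρ))
      (f := fun r : Set.Icc (0 : ℝ) 1 => s - (r : ℝ) * τ) (by fun_prop))).bddAbove
  refine integral_Iic_le_of_backward_halving hcont hτ
    (Real.iSup_nonneg fun _ => (exp_pos _).le) (fun x => ?_) (fun x hx => ?_)
  · have hhalf : exp (-∫ ρ in (x - τ)..x, α ρ) ≤ 1 / 2 := by
      rw [exp_neg, ← one_div]
      exact one_div_le_one_div_of_le two_pos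
        (by linarith [hα_int x, add_one_le_exp (∫ ρ in (x - τ)..x, α ρ)])
    rw [← intervalIntegral.integral_add_adjacent_intervals (hii (x - τ) x) (hii x s), neg_add,
      exp_add]
    linarith [mul_le_mul_of_nonneg_right hhalf (exp_pos (-∫ ρ in x..s, α ρ)).le]
  · have hr : (s - x) / τ ∈ Set.Icc (0 : ℝ) 1 :=
      ⟨div_nonneg (by linarith [hx.2]) hτ.le, (div_le_one hτ).2 (by linarith [hx.1])⟩
    simpa [div_mul_cancel₀ _ hτ.ne'] using le_ciSup hbdd ⟨(s - x) / τ, hr⟩
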